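/- Let T>0 and let (u,P) be a solution of the incompressible Euler equation on [0,T]×ℝ³ (as in the context) with vorticity ω = curl u; assume moreover that ω(t,·) is compactly supported for each t ∈ [0,T] (uniformly: there is R>0 with ω(t,x)=0 for |x|≥R and all t). Let (v,P') be a solution of the linearized Euler equation about u on [0,T]×ℝ³ with v of class C¹, v and ∂ₓv bounded, and P' C¹ in space. Then the pairing t ↦ ∫_{ℝ³} ⟨ω(t,x), v(t,x)⟩ dx is constant on [0,T]: for all t, ∫ ⟨ω(t,x),v(t,x)⟩ dx = ∫ ⟨ω(0,x),v(0,x)⟩ dx. (This is the duality between the vorticity equation ∂ₜω + (u·∇)ω − (∂ₓu)ω = 0 and the linearized Euler equation, which yields ‖ω(T)‖_{L^∞} ≤ ρ_b(T) ‖ω⁰‖_{L^∞} for the backward L¹ growth ρ_b of the linearized semigroup.) -/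

import Mathlib

noncomputable section

open MeasureTheory Set
open scoped RealInnerProductSpace ENNReal

abbrev E3 := EuclideanSpace ℝ (Fin 3)

/-- The `i`-th standard basis vector of `ℝ³`. -/
def e3 (i : Fin 3) : E3 := EuclideanSpace.single i 1

/-- The spatial partial derivative `∂ⱼ fᵢ (x)`. -/
def pd3 (f : E3 → E3) (j i : Fin 3) (x : E3) : ℝ := fderiv ℝ f x (e3 j) i

/-- The curl of a vector field on `ℝ³`. -/
def curl3 (f : E3 → E3) (x : E3) : E3 :=
  (WithLp.equiv 2 (Fin 3 → ℝ)).symm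
    ![pd3 f 1 2 x - pd3 f 2 1 x, pd3 f 2 0 x - pd3 f 0 2 x, pd3 f 0 1 x - pd3 f 1 0 x]

/-- The divergence of a vector field on `ℝ³`. -/
def div3 (f : E3 → E3) (x : E3) : ℝ := ∑ i, pd3 f i i x

/-- The transpose of the spatial Jacobian of `f` at `x`, applied to `ξ`:
`(∂ₓf(x))ᵀ ξ`, where `(∂ₓf)_{ij} = ∂ⱼfᵢ`. -/
def jacT (f : E3 → E3) (x ξ : E3) : E3 :=
  (WithLp.equiv 2 (Fin 3 → ℝ)).symm (fun i => ⟪ξ, fderiv ℝ f x (e3 i)⟫)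

/-- The cross product on `ℝ³`. -/
def cross3 (a b : E3) : E3 :=
  (WithLp.equiv 2 (Fin 3 → ℝ)).symm
    ![a 1 * b 2 - a 2 * b 1, a 2 * b 0 - a 0 * b 2, a 0 * b 1 - a 1 * b 0]

/-- `(u, P)` is a solution of the incompressible Euler equation on `[0,T] × ℝ³`:
`u` is C¹ in time and C² in space, `u` and its first and second spatial derivatives are
continuous and bounded on `[0,T] × ℝ³`, and `∂ₜu + (u·∇)u + ∇P = 0`, `div u = 0` hold
pointwise on `[0,T] × ℝ³`. -/
structure IsEulerSolutionOn (u : ℝ → E3 → E3) (P : ℝ → E3 → ℝ) (T : ℝ) : Prop where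
  u_time_C1 : ∀ x, ContDiff ℝ 1 fun t => u t x
  u_space_C2 : ∀ t, ContDiff ℝ 2 (u t)
  cont_u : Continuous fun q : ℝ × E3 => u q.1 q.2
  cont_du : Continuous fun q : ℝ × E3 => fderiv ℝ (u q.1) q.2
  cont_d2u : Continuous fun q : ℝ × E3 => fderiv ℝ (fderiv ℝ (u q.1)) q.2
  bdd : ∃ C : ℝ, ∀ t ∈ Icc 0 T, ∀ x : E3, ‖u t x‖ ≤ C ∧ ‖fderiv ℝ (u t) x‖ ≤ C ∧
      ‖fderiv ℝ (fderiv ℝ (u t)) x‖ ≤ C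
  P_space_C1 : ∀ t, ContDiff ℝ 1 (P t)
  momentum : ∀ t ∈ Icc 0 T, ∀ x : E3,
      deriv (fun s => u s x) t + fderiv ℝ (u t) x (u t x) + gradient (P t) x = 0
  incompressible : ∀ t ∈ Icc 0 T, ∀ x : E3, div3 (u t) x = 0

/-- `(v, P')` is a solution of the linearization of the Euler equation about `u`
on `[0,T] × ℝ³`: `v` is C¹, `P'` is C¹ in space, and
`∂ₜv + (u·∇)v + (v·∇)u + ∇P' = 0`, `div v = 0` hold pointwise on `[0,T] × ℝ³`. -/
structure IsLinEulerSolutionOn (u v : ℝ → E3 → E3) (P' : ℝ → E3 → ℝ) (T : ℝ) : Prop where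
  v_C1 : ContDiff ℝ 1 fun q : ℝ × E3 => v q.1 q.2
  P'_space_C1 : ∀ t, ContDiff ℝ 1 (P' t)
  momentum : ∀ t ∈ Icc 0 T, ∀ x : E3,
      deriv (fun s => v s x) t + fderiv ℝ (v t) x (u t x) + fderiv ℝ (u t) x (v t x)
        + gradient (P' t) x = 0
  incompressible : ∀ t ∈ Icc 0 T, ∀ x : E3, div3 (v t) x = 0

/-- `(γ, ξ, b)` is a solution of the bicharacteristic-amplitude system along `u` on `[0,T]`:
`ξ(t) ≠ 0`, `γ' = u(t,γ)`, `ξ' = −(∂ₓu)ᵀξ`, and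
`b' = −(∂ₓu)b + 2 (⟨ξ, (∂ₓu)b⟩/|ξ|²) ξ` along `γ`. -/
structure IsBicharSolution (u : ℝ → E3 → E3) (T : ℝ) (γ ξ b : ℝ → E3) : Prop where
  xi_ne : ∀ t ∈ Icc 0 T, ξ t ≠ 0
  hgamma : ∀ t ∈ Icc 0 T, HasDerivAt γ (u t (γ t)) t
  hxi : ∀ t ∈ Icc 0 T, HasDerivAt ξ (-jacT (u t) (γ t) (ξ t)) t
  hb : ∀ t ∈ Icc 0 T, HasDerivAt b
      (-(fderiv ℝ (u t) (γ t) (b t)) +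
        (2 * ⟪ξ t, fderiv ℝ (u t) (γ t) (b t)⟫ / ‖ξ t‖ ^ 2) • ξ t) t


open Filter Topology

/-- derivative of `(u·∇)u`. -/
def convD (u : ℝ → E3 → E3) (s : ℝ) (x : E3) : E3 →L[ℝ] E3 :=
  (fderiv ℝ (u s) x).comp (fderiv ℝ (u s) x) + (fderiv ℝ (fderiv ℝ (u s)) x).flip (u s x)

theorem convD_cont {u P T} (hu : IsEulerSolutionOn u P T) :
    Continuous fun q : ℝ × E3 => convD u q.1 q.2 := by
  unfold convD
  have h1 := hu.cont_du
  have h2 := hu.cont_u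
  have h3 := hu.cont_d2u
  refine (h1.clm_comp h1).add ?_
  have : Continuous fun q : ℝ × E3 => (fderiv ℝ (fderiv ℝ (u q.1)) q.2).flip :=
    (ContinuousLinearMap.flipₗᵢ ℝ E3 E3 E3).continuous.comp h3
  exact this.clm_apply h2

theorem convD_hasFDerivAt {u P T} (hu : IsEulerSolutionOn u P T) (s : ℝ) (x : E3) :
    HasFDerivAt (fun y => fderiv ℝ (u s) y (u s y)) (convD u s x) x := by
  have h2 := hu.u_space_C2 s
  have hd : Differentiable ℝ (u s) := h2.differentiable (by norm_num)
  have hd2 : Differentiable ℝ (fderiv ℝ (u s)) :=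
    (h2.fderiv_right (m := 1) (by norm_num)).differentiable (by norm_num)
  exact (hd2 x).hasFDerivAt.clm_apply (hd x).hasFDerivAt

theorem convD_bdd {u P T} (hu : IsEulerSolutionOn u P T) :
    ∃ C : ℝ, ∀ t ∈ Icc 0 T, ∀ x : E3, ‖fderiv ℝ (u t) x (u t x)‖ ≤ C ∧ ‖convD u t x‖ ≤ C := by
  obtain ⟨C, hC⟩ := hu.bdd
  refine ⟨C * C + C * C, fun t ht x => ?_⟩
  obtain ⟨h0, h1, h2⟩ := hC t ht x
  have hC0 : 0 ≤ C := (norm_nonneg _).trans h0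
  constructor
  · have : ‖fderiv ℝ (u t) x (u t x)‖ ≤ C * C :=
      (ContinuousLinearMap.le_opNorm _ _).trans (by gcongr)
    nlinarith [mul_nonneg hC0 hC0]
  · unfold convD
    refine (norm_add_le _ _).trans (add_le_add ?_ ?_)
    · exact (ContinuousLinearMap.opNorm_comp_le _ _).trans (by gcongr)
    · refine (ContinuousLinearMap.le_opNorm _ _).trans ?_
      rw [ContinuousLinearMap.opNorm_flip]; gcongr

/-- minus the pressure gradient. -/
def nG (u : ℝ → E3 → E3) (s : ℝ) (x : E3) : E3 :=
  -(deriv (fun s => u s x) s) - fderiv ℝ (u s) x (u s x)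

theorem conv_cont {u P T} (hu : IsEulerSolutionOn u P T) :
    Continuous fun q : ℝ × E3 => fderiv ℝ (u q.1) q.2 (u q.1 q.2) :=
  hu.cont_du.clm_apply hu.cont_u

theorem nG_cont_time {u P T} (hu : IsEulerSolutionOn u P T) (x : E3) :
    Continuous fun s => nG u s x := by
  unfold nG
  have h1 : Continuous (deriv (fun s => u s x)) := (hu.u_time_C1 x).continuous_deriv le_rfl
  have h2 : Continuous fun s : ℝ => fderiv ℝ (u s) x (u s x) :=
    (conv_cont hu).comp (Continuous.prodMk_left x)
  exact h1.neg.sub h2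

theorem nG_grad {u P T} (hu : IsEulerSolutionOn u P T) {s : ℝ} (hs : s ∈ Icc 0 T) (x : E3) :
    HasFDerivAt (P s) (innerSL ℝ (nG u s x)) x := by
  have h := hu.momentum s hs x
  have h' : nG u s x = gradient (P s) x := by
    unfold nG
    have := eq_neg_of_add_eq_zero_right h
    rw [this]; abel
  rw [h']
  exact (((hu.P_space_C1 s).differentiable (by norm_num)) x).hasGradientAt.hasFDerivAt

theorem nG_cont_space {u P T} (hu : IsEulerSolutionOn u P T) {s : ℝ} (hs : s ∈ Icc 0 T) :
    Continuous fun x => nG u s x := by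
  have h1 : Continuous (fderiv ℝ (P s)) := (hu.P_space_C1 s).continuous_fderiv (by norm_num)
  have h2 : (fun x => nG u s x) = fun x => (InnerProductSpace.toDual ℝ E3).symm (fderiv ℝ (P s) x) := by
    ext1 x
    rw [(nG_grad hu hs x).fderiv]
    rw [LinearIsometryEquiv.eq_symm_apply]
    rfl
  rw [h2]
  exact (LinearIsometryEquiv.continuous _).comp h1

theorem nG_dense {u P T} (hu : IsEulerSolutionOn u P T) :
    Dense (⋃ n : ℕ, interior {x | ∀ s ∈ Icc 0 T, ‖nG u s x‖ ≤ n}) := by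
  apply dense_iUnion_interior_of_closed
  · intro n
    have : {x | ∀ s ∈ Icc 0 T, ‖nG u s x‖ ≤ n} = ⋂ s ∈ Icc 0 T, {x | ‖nG u s x‖ ≤ n} := by
      ext; simp
    rw [this]
    refine isClosed_biInter fun s hs => ?_
    exact isClosed_le (nG_cont_space hu hs).norm continuous_const
  · rw [eq_univ_iff_forall]
    intro x
    obtain ⟨C, hC⟩ := isCompact_Icc.exists_bound_of_continuousOn (s := Icc 0 T)
      (nG_cont_time hu x).continuousOn
    obtain ⟨n, hn⟩ := exists_nat_ge C
    exact mem_iUnion.2 ⟨n, fun s hs => (hC s hs).trans hn⟩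

/-- The time-integrated velocity gradient defect. -/
def MM (u : ℝ → E3 → E3) (t : ℝ) (x : E3) : E3 →L[ℝ] E3 :=
  fderiv ℝ (u t) x - fderiv ℝ (u 0) x + ∫ s in (0:ℝ)..t, convD u s x

theorem MM_cont {u P T} (hu : IsEulerSolutionOn u P T) (t : ℝ) :
    Continuous (MM u t) := by
  unfold MM
  have h1 : ∀ s, Continuous fun x => fderiv ℝ (u s) x := fun s =>
    hu.cont_du.comp (Continuous.prodMk_right s)
  refine ((h1 t).sub (h1 0)).add ?_
  apply intervalIntegral.continuous_parametric_intervalIntegral_of_continuous'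
  exact (convD_cont hu).comp continuous_swap

theorem int_nG {u P T} (hu : IsEulerSolutionOn u P T) (t : ℝ) (x : E3) :
    ∫ s in (0:ℝ)..t, nG u s x = -(u t x - u 0 x + ∫ s in (0:ℝ)..t, fderiv ℝ (u s) x (u s x)) := by
  have h1 : Continuous (deriv (fun s => u s x)) := (hu.u_time_C1 x).continuous_deriv le_rfl
  have h2 : Continuous fun s : ℝ => fderiv ℝ (u s) x (u s x) :=
    (conv_cont hu).comp (Continuous.prodMk_left x)
  unfold nG
  rw [intervalIntegral.integral_sub ((show Continuous fun s => -deriv (fun s => u s x) s from h1.neg).intervalIntegrable _ _) (h2.intervalIntegrable _ _),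
    intervalIntegral.integral_neg, intervalIntegral.integral_deriv_eq_sub
      (fun s _ => (hu.u_time_C1 x).differentiable (by norm_num) s) (h1.intervalIntegrable _ _)]
  abel

theorem MM_hasFDerivAt {u P T} (hu : IsEulerSolutionOn u P T) {t : ℝ} (ht : t ∈ Icc 0 T) (x : E3) :
    HasFDerivAt (fun y => ∫ s in (0:ℝ)..t, nG u s y) (-(MM u t x)) x := by
  have hd : ∀ s, HasFDerivAt (u s) (fderiv ℝ (u s) x) x := fun s =>
    ((hu.u_space_C2 s).differentiable (by norm_num) x).hasFDerivAt
  have e : (fun y => ∫ s in (0:ℝ)..t, nG u s y) =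
    fun y => -(u t y - u 0 y + ∫ s in (0:ℝ)..t, fderiv ℝ (u s) y (u s y)) :=
    funext fun y => int_nG hu t y
  rw [e]
  obtain ⟨C, hC⟩ := convD_bdd hu
  have hsub : ∀ s, s ∈ uIoc 0 t → s ∈ Icc 0 T := by
    intro s hs
    rw [uIoc_of_le ht.1] at hs
    exact ⟨hs.1.le, hs.2.trans ht.2⟩
  refine (((hd t).sub (hd 0)).add ?_).neg
  have hc : ∀ y, Continuous fun s : ℝ => fderiv ℝ (u s) y (u s y) := fun y =>
    (conv_cont hu).comp (Continuous.prodMk_left y)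
  have hc' : Continuous fun s : ℝ => convD u s x :=
    (convD_cont hu).comp (Continuous.prodMk_left x)
  exact intervalIntegral.hasFDerivAt_integral_of_dominated_of_fderiv_le (s := univ)
    (F := fun y s => fderiv ℝ (u s) y (u s y)) (F' := fun y s => convD u s y)
    (bound := fun _ => C) univ_mem
    (Eventually.of_forall fun y => (hc y).aestronglyMeasurable)
    ((hc x).intervalIntegrable _ _) hc'.aestronglyMeasurable
    (Eventually.of_forall fun s hs y _ => (hC s (hsub s hs) y).2)
    (continuous_const.intervalIntegrable _ _)
    (Eventually.of_forall fun s hs y _ => convD_hasFDerivAt hu s y)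

theorem Q_hasFDerivAt {u P T} (hu : IsEulerSolutionOn u P T) {t : ℝ} (ht : t ∈ Icc 0 T) (x0 : E3)
    (r C : ℝ) (hr : 0 < r)
    (hC : ∀ x ∈ Metric.ball x0 r, ∀ s ∈ Icc 0 T, ‖nG u s x‖ ≤ C) (x : E3)
    (hx : x ∈ Metric.ball x0 r) :
    HasFDerivAt (fun y => ∫ s in (0:ℝ)..t, (P s y - P s x0))
      (innerSL ℝ (∫ s in (0:ℝ)..t, nG u s x)) x := by
  have hsub : ∀ s, s ∈ uIoc 0 t → s ∈ Icc 0 T := by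
    intro s hs
    rw [uIoc_of_le ht.1] at hs
    exact ⟨hs.1.le, hs.2.trans ht.2⟩
  have hcontF : ∀ y ∈ Metric.ball x0 r, ContinuousOn (fun s => P s y - P s x0) (Icc 0 t) := by
    intro y hy
    have hseg : ∀ σ ∈ Icc (0:ℝ) 1, x0 + σ • (y - x0) ∈ Metric.ball x0 r := by
      intro σ hσ
      rw [mem_ball_iff_norm] at hy ⊢
      rw [add_sub_cancel_left, norm_smul, Real.norm_eq_abs, abs_of_nonneg hσ.1]
      calc σ * ‖y - x0‖ ≤ 1 * ‖y - x0‖ := by gcongr; exact hσ.2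
        _ < r := by rwa [one_mul]
    have hcs : ∀ s ∈ Icc 0 t, Continuous fun σ : ℝ => ⟪nG u s (x0 + σ • (y - x0)), y - x0⟫ := by
      intro s hs
      have := nG_cont_space hu (s := s) ⟨hs.1, hs.2.trans ht.2⟩
      have h2 : Continuous fun σ : ℝ => nG u s (x0 + σ • (y - x0)) := this.comp (by fun_prop)
      exact h2.inner continuous_const
    have heq : ∀ s ∈ Icc 0 t, P s y - P s x0 =
        ∫ σ in (0:ℝ)..1, ⟪nG u s (x0 + σ • (y - x0)), y - x0⟫ := by
      intro s hs
      rw [intervalIntegral.integral_eq_sub_of_hasDerivAt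
        (f := fun σ : ℝ => P s (x0 + σ • (y - x0)))]
      · simp
      · intro σ _
        have h1 : HasDerivAt (fun σ : ℝ => x0 + σ • (y - x0)) (y - x0) σ := by
          simpa using ((hasDerivAt_id σ).smul_const (y - x0)).const_add x0
        have h2 := (nG_grad hu (s := s) ⟨hs.1, hs.2.trans ht.2⟩ (x0 + σ • (y - x0))).comp_hasDerivAt σ h1
        exact h2
      · exact (hcs s hs).intervalIntegrable _ _
    refine ContinuousOn.congr ?_ heq
    intro s hs
    refine intervalIntegral.continuousWithinAt_of_dominated_interval
      (bound := fun _ => C * ‖y - x0‖) ?_ ?_ (continuous_const.intervalIntegrable _ _) ?_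
    · filter_upwards [self_mem_nhdsWithin] with s' hs'
      exact (hcs s' hs').aestronglyMeasurable
    · filter_upwards [self_mem_nhdsWithin] with s' hs'
      refine Eventually.of_forall fun σ hσ => ?_
      rw [uIoc_of_le zero_le_one] at hσ
      refine (norm_inner_le_norm _ _).trans ?_
      gcongr
      exact hC _ (hseg σ ⟨hσ.1.le, hσ.2⟩) s' ⟨hs'.1, hs'.2.trans ht.2⟩
    · refine Eventually.of_forall fun σ hσ => ?_
      exact ((nG_cont_time hu _).inner continuous_const).continuousWithinAt
  have hcg : Continuous fun s : ℝ => innerSL ℝ (nG u s x) :=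
    (innerSL ℝ (E := E3)).continuous.comp (nG_cont_time hu x)
  rw [← ContinuousLinearMap.intervalIntegral_comp_comm _ ((nG_cont_time hu x).intervalIntegrable _ _)]
  exact intervalIntegral.hasFDerivAt_integral_of_dominated_of_fderiv_le (s := Metric.ball x0 r)
    (F := fun y s => P s y - P s x0) (F' := fun y s => innerSL ℝ (nG u s y))
    (bound := fun _ => C) (Metric.isOpen_ball.mem_nhds hx)
    (by
      filter_upwards [Metric.isOpen_ball.mem_nhds hx] with y hy
      rw [uIoc_of_le ht.1]
      exact ((hcontF y hy).mono Ioc_subset_Icc_self).aestronglyMeasurable measurableSet_Ioc)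
    (by
      apply ContinuousOn.intervalIntegrable
      rw [uIcc_of_le ht.1]; exact hcontF x hx)
    hcg.aestronglyMeasurable
    (Eventually.of_forall fun s hs y hy => by
      rw [innerSL_apply_norm]; exact hC y hy s (hsub s hs))
    (continuous_const.intervalIntegrable _ _)
    (Eventually.of_forall fun s hs y _ => (nG_grad hu (hsub s hs) y).sub_const _)

theorem MM_symm {u P T} (hu : IsEulerSolutionOn u P T) {t : ℝ} (ht : t ∈ Icc 0 T) (a b x : E3) :
    ⟪MM u t x a, b⟫ = ⟪MM u t x b, a⟫ := by
  have hcl : IsClosed {x | ⟪MM u t x a, b⟫ = ⟪MM u t x b, a⟫} := by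
    have := MM_cont hu t
    exact isClosed_eq ((this.clm_apply continuous_const).inner continuous_const)
      ((this.clm_apply continuous_const).inner continuous_const)
  have hd := nG_dense hu
  have hsub : (⋃ n : ℕ, interior {x | ∀ s ∈ Icc 0 T, ‖nG u s x‖ ≤ n}) ⊆
      {x | ⟪MM u t x a, b⟫ = ⟪MM u t x b, a⟫} := by
    intro x hx
    obtain ⟨n, hn⟩ := mem_iUnion.1 hx
    obtain ⟨r, hr, hb⟩ := Metric.isOpen_iff.1 isOpen_interior x hn
    have hQ := Q_hasFDerivAt hu ht x r n hr (fun y hy => interior_subset (hb hy))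
    have hM := MM_hasFDerivAt hu ht x
    have h2 := (innerSL ℝ (E := E3)).hasFDerivAt.comp x hM
    have := second_derivative_symmetric_of_eventually (𝕜 := ℝ)
      (f' := fun y => innerSL ℝ (∫ s in (0:ℝ)..t, nG u s y))
      (by filter_upwards [Metric.ball_mem_nhds x hr] with y hy using hQ y hy) h2 a b
    have h3 : -⟪MM u t x a, b⟫ = -⟪MM u t x b, a⟫ := by
      rw [← inner_neg_left, ← inner_neg_left]; exact this
    exact neg_injective h3
  exact (hcl.closure_subset_iff.2 hsub) (hd x)

/-- Components of the vorticity. -/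
def om (u : ℝ → E3 → E3) (t : ℝ) (i : Fin 3) (x : E3) : ℝ :=
  fderiv ℝ (u t) x (e3 (i+1)) (i+2) - fderiv ℝ (u t) x (e3 (i+2)) (i+1)

/-- Minus the time derivative of the vorticity. -/
def KK (u : ℝ → E3 → E3) (t : ℝ) (i : Fin 3) (x : E3) : ℝ :=
  convD u t x (e3 (i+1)) (i+2) - convD u t x (e3 (i+2)) (i+1)

theorem curl_om (u : ℝ → E3 → E3) (t : ℝ) (i : Fin 3) (x : E3) :
    curl3 (u t) x i = om u t i x := by
  fin_cases i <;> simp [curl3, pd3, om]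

/-- Matrix entry functional. -/
def ent (k m : Fin 3) : (E3 →L[ℝ] E3) →L[ℝ] ℝ :=
  (EuclideanSpace.proj m : E3 →L[ℝ] ℝ).comp (ContinuousLinearMap.apply ℝ E3 (e3 k))

theorem ent_apply (k m : Fin 3) (A : E3 →L[ℝ] E3) : ent k m A = A (e3 k) m := rfl

/-- Curl functional. -/
def cfun (i : Fin 3) : (E3 →L[ℝ] E3) →L[ℝ] ℝ := ent (i+1) (i+2) - ent (i+2) (i+1)

theorem cfun_apply (i : Fin 3) (A : E3 →L[ℝ] E3) :
    cfun i A = A (e3 (i+1)) (i+2) - A (e3 (i+2)) (i+1) := rfl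

theorem om_eq (u : ℝ → E3 → E3) (t : ℝ) (i : Fin 3) (x : E3) :
    om u t i x = cfun i (fderiv ℝ (u t) x) := rfl

theorem KK_eq (u : ℝ → E3 → E3) (t : ℝ) (i : Fin 3) (x : E3) :
    KK u t i x = cfun i (convD u t x) := rfl

theorem inner_e3 (w : E3) (j : Fin 3) : ⟪w, e3 j⟫ = w j := by
  simp [e3, EuclideanSpace.inner_single_right]

theorem om_int {u P T} (hu : IsEulerSolutionOn u P T) {t : ℝ} (ht : t ∈ Icc 0 T)
    (i : Fin 3) (x : E3) :
    om u t i x = om u 0 i x - ∫ s in (0:ℝ)..t, KK u s i x := by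
  have h := MM_symm hu ht (e3 (i+1)) (e3 (i+2)) x
  rw [inner_e3, inner_e3] at h
  have h2 : cfun i (MM u t x) = 0 := by rw [cfun_apply, h, sub_self]
  have hc : Continuous fun s : ℝ => convD u s x :=
    (convD_cont hu).comp (Continuous.prodMk_left x)
  have h3 : cfun i (∫ s in (0:ℝ)..t, convD u s x) = ∫ s in (0:ℝ)..t, KK u s i x :=
    (ContinuousLinearMap.intervalIntegral_comp_comm (cfun i) (hc.intervalIntegrable _ _)).symm
  rw [MM, map_add, map_sub, h3, ← om_eq, ← om_eq] at h2
  linarith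

theorem KK_cont {u P T} (hu : IsEulerSolutionOn u P T) (i : Fin 3) :
    Continuous fun q : ℝ × E3 => KK u q.1 i q.2 := (cfun i).continuous.comp (convD_cont hu)

theorem om_cont {u P T} (hu : IsEulerSolutionOn u P T) (i : Fin 3) :
    Continuous fun q : ℝ × E3 => om u q.1 i q.2 := (cfun i).continuous.comp hu.cont_du

theorem om_deriv {u P T} (hu : IsEulerSolutionOn u P T) {t : ℝ} (ht : t ∈ Ioo 0 T)
    (i : Fin 3) (x : E3) : HasDerivAt (fun s => om u s i x) (-KK u t i x) t := by
  have hc : Continuous fun s : ℝ => KK u s i x := (KK_cont hu i).comp (Continuous.prodMk_left x)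
  have h := ((hc.integral_hasStrictDerivAt 0 t).hasDerivAt).const_sub (om u 0 i x)
  refine h.congr_of_eventuallyEq ?_
  filter_upwards [isOpen_Ioo.mem_nhds ht] with s hs
  exact om_int hu (Ioo_subset_Icc_self hs) i x

theorem vec_expand (w : E3) : w = ∑ j, w j • e3 j := by
  ext k
  fin_cases k <;> simp [e3, Fin.sum_univ_three]

theorem lin_expand (A : E3 →L[ℝ] E3) (w : E3) (m : Fin 3) :
    A w m = ∑ j, w j * A (e3 j) m := by
  conv_lhs => rw [vec_expand w]
  simp [map_sum, Fin.sum_univ_three]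

theorem lin_expand' (A : E3 →L[ℝ] ℝ) (w : E3) : A w = ∑ j, w j * A (e3 j) := by
  conv_lhs => rw [vec_expand w]
  simp [map_sum, Fin.sum_univ_three]

theorem om_fderiv {u P T} (hu : IsEulerSolutionOn u P T) (t : ℝ) (i : Fin 3) (x : E3) :
    HasFDerivAt (om u t i) ((cfun i).comp (fderiv ℝ (fderiv ℝ (u t)) x)) x := by
  have hd2 : Differentiable ℝ (fderiv ℝ (u t)) :=
    ((hu.u_space_C2 t).fderiv_right (m := 1) (by norm_num)).differentiable (by norm_num)
  exact (cfun i).hasFDerivAt.comp x (hd2 x).hasFDerivAt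

theorem om_C1 {u P T} (hu : IsEulerSolutionOn u P T) (t : ℝ) (i : Fin 3) :
    ContDiff ℝ 1 (om u t i) :=
  (cfun i).contDiff.comp ((hu.u_space_C2 t).fderiv_right (m := 1) (by norm_num))

theorem D2_symm {u P T} (hu : IsEulerSolutionOn u P T) (t : ℝ) (x a b : E3) :
    fderiv ℝ (fderiv ℝ (u t)) x a b = fderiv ℝ (fderiv ℝ (u t)) x b a :=
  ((hu.u_space_C2 t).contDiffAt.isSymmSndFDerivAt (by simp)) a b

theorem om_div {u P T} (hu : IsEulerSolutionOn u P T) (t : ℝ) (x : E3) :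
    ∑ i, fderiv ℝ (om u t i) x (e3 i) = 0 := by
  simp only [(om_fderiv hu t _ x).fderiv, Fin.sum_univ_three, ContinuousLinearMap.comp_apply,
    cfun_apply]
  simp only [show (0:Fin 3) + 1 = 1 from rfl, show (0:Fin 3) + 2 = 2 from rfl,
    show (1:Fin 3) + 1 = 2 from rfl, show (1:Fin 3) + 2 = 0 from rfl,
    show (2:Fin 3) + 1 = 0 from rfl, show (2:Fin 3) + 2 = 1 from rfl]
  rw [D2_symm hu t x (e3 1) (e3 0), D2_symm hu t x (e3 2) (e3 0), D2_symm hu t x (e3 2) (e3 1)]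
  ring

theorem KK_formula {u P T} (hu : IsEulerSolutionOn u P T) {t : ℝ} (ht : t ∈ Icc 0 T)
    (i : Fin 3) (x : E3) :
    KK u t i x = fderiv ℝ (om u t i) x (u t x) - ∑ j, fderiv ℝ (u t) x (e3 j) i * om u t j x := by
  have hdiv := hu.incompressible t ht x
  rw [(om_fderiv hu t i x).fderiv]
  unfold KK convD
  simp only [ContinuousLinearMap.comp_apply, cfun_apply, ContinuousLinearMap.add_apply,
    ContinuousLinearMap.flip_apply, PiLp.add_apply]
  rw [D2_symm hu t x (e3 (i+1)), D2_symm hu t x (e3 (i+2)), lin_expand _ (fderiv ℝ (u t) x (e3 (i+1))),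
    lin_expand _ (fderiv ℝ (u t) x (e3 (i+2)))]
  simp only [div3, pd3, Fin.sum_univ_three, om] at hdiv ⊢
  have e01 : (0:Fin 3) + 1 = 1 := rfl
  have e02 : (0:Fin 3) + 2 = 2 := rfl
  have e11 : (1:Fin 3) + 1 = 2 := rfl
  have e12 : (1:Fin 3) + 2 = 0 := rfl
  have e21 : (2:Fin 3) + 1 = 0 := rfl
  have e22 : (2:Fin 3) + 2 = 1 := rfl
  have hi : i = 0 ∨ i = 1 ∨ i = 2 := by fin_cases i <;> simp
  rcases hi with rfl | rfl | rfl
  · simp only [e01, e02, e11, e12, e21, e22]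
    linear_combination (fderiv ℝ (u t) x (e3 1) 2 - fderiv ℝ (u t) x (e3 2) 1) * hdiv
  · simp only [e01, e02, e11, e12, e21, e22]
    linear_combination (fderiv ℝ (u t) x (e3 2) 0 - fderiv ℝ (u t) x (e3 0) 2) * hdiv
  · simp only [e01, e02, e11, e12, e21, e22]
    linear_combination (fderiv ℝ (u t) x (e3 0) 1 - fderiv ℝ (u t) x (e3 1) 0) * hdiv

/-- The pairing density. -/
def ff (u v : ℝ → E3 → E3) (t : ℝ) (x : E3) : ℝ := ∑ i, om u t i x * v t x i

/-- The time derivative of the pairing density. -/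
def dd (u v : ℝ → E3 → E3) (t : ℝ) (x : E3) : ℝ :=
  ∑ i, (-KK u t i x * v t x i + om u t i x * (deriv (fun s => v s x) t) i)

theorem ff_eq (u v : ℝ → E3 → E3) (t : ℝ) (x : E3) :
    ⟪curl3 (u t) x, v t x⟫ = ff u v t x := by
  simp only [ff, PiLp.inner_apply, curl_om]
  simp [mul_comm]

theorem v_space_C1 {u v P' T} (hv : IsLinEulerSolutionOn u v P' T) (t : ℝ) :
    ContDiff ℝ 1 (v t) := hv.v_C1.comp (contDiff_prodMk_right t)

theorem v_time_C1 {u v P' T} (hv : IsLinEulerSolutionOn u v P' T) (x : E3) :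
    ContDiff ℝ 1 (fun t => v t x) := hv.v_C1.comp (contDiff_prodMk_left x)

theorem v_deriv_cont {u v P' T} (hv : IsLinEulerSolutionOn u v P' T) :
    Continuous fun q : ℝ × E3 => deriv (fun s => v s q.2) q.1 := by
  have h : (fun q : ℝ × E3 => deriv (fun s => v s q.2) q.1) =
      fun q => fderiv ℝ (fun q : ℝ × E3 => v q.1 q.2) q (1, 0) := by
    ext1 q
    have h1 := (hv.v_C1.differentiable (by norm_num) q).hasFDerivAt
    have h2 : HasDerivAt (fun s : ℝ => (s, q.2)) ((1:ℝ), (0:E3)) q.1 :=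
      (hasDerivAt_id _).prodMk (hasDerivAt_const _ _)
    exact (HasFDerivAt.comp_hasDerivAt (x := q.1) (f := fun s : ℝ => (s, q.2)) h1 h2).deriv
  rw [h]
  exact (hv.v_C1.continuous_fderiv (by norm_num)).clm_apply continuous_const

theorem ff_C1 {u P v P' T} (hu : IsEulerSolutionOn u P T) (hv : IsLinEulerSolutionOn u v P' T)
    (t : ℝ) : ContDiff ℝ 1 (ff u v t) := by
  unfold ff
  refine ContDiff.sum fun i _ => (om_C1 hu t i).mul ?_
  exact (EuclideanSpace.proj i : E3 →L[ℝ] ℝ).contDiff.comp (v_space_C1 hv t)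

theorem dd_cont {u P v P' T} (hu : IsEulerSolutionOn u P T) (hv : IsLinEulerSolutionOn u v P' T) :
    Continuous fun q : ℝ × E3 => dd u v q.1 q.2 := by
  unfold dd
  refine continuous_finsetSum _ fun i _ => ?_
  have h1 : Continuous fun q : ℝ × E3 => v q.1 q.2 i :=
    (EuclideanSpace.proj i : E3 →L[ℝ] ℝ).continuous.comp hv.v_C1.continuous
  have h2 : Continuous fun q : ℝ × E3 => (deriv (fun s => v s q.2) q.1) i :=
    (EuclideanSpace.proj i : E3 →L[ℝ] ℝ).continuous.comp (v_deriv_cont hv)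
  exact ((KK_cont hu i).neg.mul h1).add ((om_cont hu i).mul h2)

theorem ff_cont {u P v P' T} (hu : IsEulerSolutionOn u P T) (hv : IsLinEulerSolutionOn u v P' T) :
    Continuous fun q : ℝ × E3 => ff u v q.1 q.2 := by
  unfold ff
  refine continuous_finsetSum _ fun i _ => ?_
  have h1 : Continuous fun q : ℝ × E3 => v q.1 q.2 i :=
    (EuclideanSpace.proj i : E3 →L[ℝ] ℝ).continuous.comp hv.v_C1.continuous
  exact (om_cont hu i).mul h1

theorem ff_deriv {u P v P' T} (hu : IsEulerSolutionOn u P T) (hv : IsLinEulerSolutionOn u v P' T)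
    {t : ℝ} (ht : t ∈ Ioo 0 T) (x : E3) :
    HasDerivAt (fun s => ff u v s x) (dd u v t x) t := by
  unfold ff dd
  refine HasDerivAt.fun_sum fun i _ => (om_deriv hu ht i x).mul ?_
  have h := ((v_time_C1 hv x).differentiable (by norm_num) t).hasDerivAt
  exact (EuclideanSpace.proj i : E3 →L[ℝ] ℝ).hasFDerivAt.comp_hasDerivAt t h

theorem dd_formula {u P v P' T} (hu : IsEulerSolutionOn u P T)
    (hv : IsLinEulerSolutionOn u v P' T) {t : ℝ} (ht : t ∈ Icc 0 T) (x : E3) :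
    dd u v t x = -((∑ j, u t x j * fderiv ℝ (ff u v t) x (e3 j)) +
      ∑ j, P' t x * fderiv ℝ (om u t j) x (e3 j) + ∑ j, fderiv ℝ (P' t) x (e3 j) * om u t j x) := by
  rw [← Finset.mul_sum, om_div hu, mul_zero, add_zero, ← lin_expand']
  have hvd : HasFDerivAt (v t) (fderiv ℝ (v t) x) x :=
    ((v_space_C1 hv t).differentiable (by norm_num) x).hasFDerivAt
  have hf : HasFDerivAt (ff u v t) (∑ i, (om u t i x • ((EuclideanSpace.proj i : E3 →L[ℝ] ℝ).comp
      (fderiv ℝ (v t) x)) + v t x i • fderiv ℝ (om u t i) x)) x := by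
    unfold ff
    refine HasFDerivAt.fun_sum fun i _ => ?_
    refine ((om_C1 hu t i).differentiable (by norm_num) x).hasFDerivAt.mul ?_
    exact (EuclideanSpace.proj i : E3 →L[ℝ] ℝ).hasFDerivAt.comp x hvd
  rw [hf.fderiv]
  have hg : ∀ i, gradient (P' t) x i = fderiv ℝ (P' t) x (e3 i) := by
    intro i
    rw [← inner_e3, inner_gradient_left]
  have hm : ∀ i, (deriv (fun s => v s x) t) i = -(fderiv ℝ (v t) x (u t x) i)
      - ∑ j, v t x j * fderiv ℝ (u t) x (e3 j) i - fderiv ℝ (P' t) x (e3 i) := by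
    intro i
    have h := congrArg (fun w : E3 => w i) (hv.momentum t ht x)
    simp only [PiLp.add_apply, PiLp.zero_apply, hg] at h
    rw [lin_expand _ (v t x)] at h
    linarith
  have hpr : ∀ (i : Fin 3) (w : E3), (EuclideanSpace.proj i : E3 →L[ℝ] ℝ) w = w i := fun _ _ => rfl
  unfold dd
  simp only [hm, KK_formula hu ht]
  simp only [Fin.sum_univ_three, ContinuousLinearMap.add_apply, ContinuousLinearMap.smul_apply,
    ContinuousLinearMap.comp_apply, hpr, smul_eq_mul]
  simp only [om, show (0:Fin 3) + 1 = 1 from rfl, show (0:Fin 3) + 2 = 2 from rfl,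
    show (1:Fin 3) + 1 = 2 from rfl, show (1:Fin 3) + 2 = 0 from rfl,
    show (2:Fin 3) + 1 = 0 from rfl, show (2:Fin 3) + 2 = 1 from rfl]
  ring

theorem ibp (g h : Fin 3 → E3 → ℝ) (hg : ∀ i, ContDiff ℝ 1 (g i)) (hh : ∀ i, ContDiff ℝ 1 (h i))
    (hs : ∀ i, HasCompactSupport (g i)) :
    Integrable (fun x => ∑ i, h i x * fderiv ℝ (g i) x (e3 i)) ∧
    Integrable (fun x => ∑ i, fderiv ℝ (h i) x (e3 i) * g i x) ∧
    ∫ x, ∑ i, h i x * fderiv ℝ (g i) x (e3 i) = - ∫ x, ∑ i, fderiv ℝ (h i) x (e3 i) * g i x := by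
  have c1 : ∀ i, Continuous fun x => fderiv ℝ (g i) x (e3 i) := fun i =>
    ((hg i).continuous_fderiv (by norm_num)).clm_apply continuous_const
  have c2 : ∀ i, Continuous fun x => fderiv ℝ (h i) x (e3 i) := fun i =>
    ((hh i).continuous_fderiv (by norm_num)).clm_apply continuous_const
  have i1 : ∀ i, Integrable fun x => h i x * fderiv ℝ (g i) x (e3 i) := fun i =>
    ((hh i).continuous.mul (c1 i)).integrable_of_hasCompactSupport
      (((hs i).fderiv_apply ℝ (e3 i)).mul_left)
  have i2 : ∀ i, Integrable fun x => fderiv ℝ (h i) x (e3 i) * g i x := fun i =>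
    ((c2 i).mul (hg i).continuous).integrable_of_hasCompactSupport (hs i).mul_left
  have i3 : ∀ i, Integrable fun x => h i x * g i x := fun i =>
    ((hh i).continuous.mul (hg i).continuous).integrable_of_hasCompactSupport (hs i).mul_left
  refine ⟨integrable_finsetSum _ fun i _ => i1 i, integrable_finsetSum _ fun i _ => i2 i, ?_⟩
  rw [integral_finsetSum _ fun i _ => i1 i, integral_finsetSum _ fun i _ => i2 i,
    ← Finset.sum_neg_distrib]
  refine Finset.sum_congr rfl fun i _ => ?_
  exact integral_mul_fderiv_eq_neg_fderiv_mul_of_integrable (i2 i) (i1 i) (i3 i)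
    (fun x _ => (hh i).differentiable (by norm_num) x)
    (fun x _ => (hg i).differentiable (by norm_num) x)

theorem om_supp {u : ℝ → E3 → E3} {R t : ℝ} (h : ∀ x : E3, R ≤ ‖x‖ → curl3 (u t) x = 0)
    (i : Fin 3) (x : E3) (hx : R ≤ ‖x‖) : om u t i x = 0 := by
  rw [← curl_om, h x hx]; rfl

theorem cs_of {g : E3 → ℝ} {R : ℝ} (h : ∀ x : E3, R ≤ ‖x‖ → g x = 0) : HasCompactSupport g :=
  HasCompactSupport.intro (isCompact_closedBall (0:E3) R) fun x hx => h x (by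
    rw [mem_closedBall_zero_iff, not_le] at hx; exact hx.le)

theorem integral_three {a b d : E3 → ℝ} (ha : Integrable a) (hb : Integrable b)
    (hd : Integrable d) :
    ∫ x, -(a x + b x + d x) = -((∫ x, a x) + (∫ x, b x) + ∫ x, d x) := by
  rw [integral_neg, integral_add (f := fun x => a x + b x) (ha.add hb) hd, integral_add ha hb]

theorem cont_slice {F : ℝ → E3 → ℝ} (h : Continuous fun q : ℝ × E3 => F q.1 q.2) (x : E3) :
    Continuous fun s => F s x := h.comp (Continuous.prodMk_left x)

theorem dd_int_zero {u P v P' T} (hu : IsEulerSolutionOn u P T)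
    (hv : IsLinEulerSolutionOn u v P' T) {R t : ℝ} (ht : t ∈ Icc 0 T)
    (h : ∀ x : E3, R ≤ ‖x‖ → curl3 (u t) x = 0) :
    ∫ x, dd u v t x = 0 := by
  have hom := om_supp h
  have hff : ∀ x : E3, R ≤ ‖x‖ → ff u v t x = 0 := fun x hx => by
    simp [ff, hom _ x hx]
  obtain ⟨a1, a2, a3⟩ := ibp (fun _ => ff u v t) (fun i x => u t x i) (fun _ => ff_C1 hu hv t)
    (fun i => (EuclideanSpace.proj i : E3 →L[ℝ] ℝ).contDiff.comp
      ((hu.u_space_C2 t).of_le (by norm_num))) (fun _ => cs_of hff)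
  obtain ⟨b1, b2, b3⟩ := ibp (fun i => om u t i) (fun _ => P' t) (om_C1 hu t)
    (fun _ => hv.P'_space_C1 t) (fun i => cs_of (hom i))
  have hI := integral_three a1 b1 b2
  rw [a3, b3] at hI
  have hE : ∫ x, dd u v t x = _ := (integral_congr_ae (Eventually.of_forall fun x => dd_formula hu hv ht x)).trans hI
  rw [hE]
  have hz : ∀ x, ∑ i, fderiv ℝ (fun x => u t x i) x (e3 i) * ff u v t x = 0 := by
    intro x
    rw [← Finset.sum_mul]
    have hd : ∀ i, fderiv ℝ (fun x => u t x i) x (e3 i) = pd3 (u t) i i x := by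
      intro i
      have := (EuclideanSpace.proj i : E3 →L[ℝ] ℝ).hasFDerivAt.comp x
        ((hu.u_space_C2 t).differentiable (by norm_num) x).hasFDerivAt
      have h2 : fderiv ℝ (fun x => u t x i) x = _ := this.fderiv
      rw [h2]; rfl
    have := hu.incompressible t ht x
    rw [div3] at this
    simp only [hd, this, zero_mul]
  simp only [hz]
  simp

theorem dd_supp {u P v P' T} (hu : IsEulerSolutionOn u P T)
    (hv : IsLinEulerSolutionOn u v P' T) {R t : ℝ} (ht : t ∈ Icc 0 T)
    (h : ∀ x : E3, R ≤ ‖x‖ → curl3 (u t) x = 0) (x : E3) (hx : R < ‖x‖) :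
    dd u v t x = 0 := by
  have hom := om_supp h
  have hff : ff u v t =ᶠ[𝓝 x] fun _ => 0 := by
    filter_upwards [(isOpen_lt continuous_const continuous_norm).mem_nhds hx] with y hy
    simp [ff, hom _ y (le_of_lt hy)]
  rw [dd_formula hu hv ht, ← Finset.mul_sum, om_div hu, hff.fderiv_eq]
  simp [hom _ x hx.le]

/-- (Duality between the vorticity equation and the linearized Euler
equation.) For a smooth bounded Euler solution `(u, P)` on `[0,T] × ℝ³` whose vorticity
`ω = curl u` is (uniformly) compactly supported, and a solution `(v, P')` of the linearized
Euler equation about `u` with `v` C¹, `v` and `∂ₓv` bounded and `P'` C¹ in space, the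
pairing `∫ ⟨ω(t,x), v(t,x)⟩ dx` is constant on `[0,T]`. -/
theorem stmt15 (T : ℝ) (hT : 0 < T)
    (u : ℝ → E3 → E3) (P : ℝ → E3 → ℝ) (hu : IsEulerSolutionOn u P T)
    (R : ℝ) (hR : 0 < R)
    (hsupp : ∀ t ∈ Icc 0 T, ∀ x : E3, R ≤ ‖x‖ → curl3 (u t) x = 0)
    (v : ℝ → E3 → E3) (P' : ℝ → E3 → ℝ)
    (hv : IsLinEulerSolutionOn u v P' T)
    (hvbdd : ∃ C : ℝ, ∀ t ∈ Icc 0 T, ∀ x : E3, ‖v t x‖ ≤ C ∧ ‖fderiv ℝ (v t) x‖ ≤ C) :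
    ∀ t ∈ Icc 0 T,
      ∫ x : E3, ⟪curl3 (u t) x, v t x⟫ = ∫ x : E3, ⟪curl3 (u 0) x, v 0 x⟫ := by
  intro t ht
  simp only [ff_eq]
  have h0 : (0:ℝ) ∈ Icc 0 T := ⟨le_rfl, hT.le⟩
  have hfi : ∀ s ∈ Icc 0 T, Integrable (ff u v s) := fun s hs =>
    (ff_C1 hu hv s).continuous.integrable_of_hasCompactSupport (cs_of (R := R) fun x hx => by
      simp [ff, om_supp (hsupp s hs) _ x hx])
  have hFTC : ∀ x, ff u v t x - ff u v 0 x = ∫ s in (0:ℝ)..t, dd u v s x := by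
    intro x
    have c1 : Continuous fun s : ℝ => ff u v s x := cont_slice (F := ff u v) (ff_cont hu hv) x
    have c2 : Continuous fun s : ℝ => dd u v s x := cont_slice (F := dd u v) (dd_cont hu hv) x
    have := intervalIntegral.integral_eq_sub_of_hasDerivAt_of_le (f := fun s => ff u v s x)
      (f' := fun s => dd u v s x) ht.1 c1.continuousOn
      (fun s hs => ff_deriv hu hv ⟨hs.1, hs.2.trans_le ht.2⟩ x) (c2.intervalIntegrable _ _)
    exact this.symm
  rw [← sub_eq_zero, ← integral_sub (hfi t ht) (hfi 0 h0)]
  simp only [hFTC]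
  have hz : ∀ s ∈ Icc 0 t, ∀ x ∉ Metric.closedBall (0:E3) R, dd u v s x = 0 := by
    intro s hs x hx
    rw [mem_closedBall_zero_iff, not_le] at hx
    exact dd_supp hu hv ⟨hs.1, hs.2.trans ht.2⟩ (hsupp s ⟨hs.1, hs.2.trans ht.2⟩) x hx
  have e1 : ∫ x, ∫ s in (0:ℝ)..t, dd u v s x =
      ∫ x in Metric.closedBall (0:E3) R, ∫ s in (0:ℝ)..t, dd u v s x := by
    symm
    apply setIntegral_eq_integral_of_forall_compl_eq_zero
    intro x hx
    rw [intervalIntegral.integral_congr (g := fun _ => (0:ℝ))]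
    · simp
    · intro s hs
      rw [uIcc_of_le ht.1] at hs
      exact hz s hs x hx
  rw [e1, ← intervalIntegral_integral_swap]
  · rw [intervalIntegral.integral_congr (g := fun _ => (0:ℝ))]
    · simp
    · intro s hs
      rw [uIcc_of_le ht.1] at hs
      have hs' : s ∈ Icc 0 T := ⟨hs.1, hs.2.trans ht.2⟩
      show ∫ x in Metric.closedBall (0:E3) R, dd u v s x = 0
      rw [setIntegral_eq_integral_of_forall_compl_eq_zero (hz s hs)]
      exact dd_int_zero hu hv hs' (hsupp s hs')
  · rw [Measure.prod_restrict, ← Measure.volume_eq_prod]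
    have : IntegrableOn (Function.uncurry fun s x => dd u v s x)
        (Icc 0 t ×ˢ Metric.closedBall (0:E3) R) :=
      (show Continuous (Function.uncurry fun s x => dd u v s x) from dd_cont hu hv).continuousOn.integrableOn_compact
        (isCompact_Icc.prod (isCompact_closedBall _ _))
    refine this.mono_set (Set.prod_mono ?_ le_rfl)
    rw [uIoc_of_le ht.1]; exact Ioc_subset_Icc_self
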